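/- R × R₂ = S ⊕ ι(R₁): every element of R × R₂ decomposes uniquely as s + ι(w) with s ∈ S and w ∈ R₁. -/

import Mathlib

open Matrix

noncomputable section

/-- `ψ_M(x, y) = xᵀ M y`, the bilinear form on `ℚᵏ` associated with an integer matrix `M`. -/
def psi {k : ℕ} (M : Matrix (Fin k) (Fin k) ℤ) (x y : Fin k → ℚ) : ℚ :=
  x ⬝ᵥ ((M.map (fun a => (a : ℚ))) *ᵥ y)

/-- A rational number is an integer. -/
def IsIntQ (q : ℚ) : Prop := ∃ a : ℤ, q = a

/-- A rational vector has integer entries, i.e. belongs to the lattice `ℤᵏ ⊂ ℚᵏ`. -/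
def IsIntVec {k : ℕ} (x : Fin k → ℚ) : Prop := ∀ i, IsIntQ (x i)

/-- `x` belongs to the dual lattice of `ℤᵏ` with respect to `ψ_M`. -/
def InDual {k : ℕ} (M : Matrix (Fin k) (Fin k) ℤ) (x : Fin k → ℚ) : Prop :=
  ∀ y, IsIntVec y → IsIntQ (psi M x y)

/-- The form `ψ_R` on `V₁ × V₁`:
`ψ_R((x,y),(x',y')) = ψ_A(x,y') + ψ_A(x',y) + ψ_A(y,y') − ψ_B(f(y),f(y'))`. -/
def psiR {n m : ℕ} (A : Matrix (Fin n) (Fin n) ℤ) (B : Matrix (Fin m) (Fin m) ℤ)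
    (f : (Fin n → ℚ) →ₗ[ℚ] (Fin m → ℚ)) (u v : (Fin n → ℚ) × (Fin n → ℚ)) : ℚ :=
  psi A u.1 v.2 + psi A v.1 u.2 + psi A u.2 v.2 - psi B (f u.2) (f v.2)

/-- Membership in the lattice `R = R₁ × R₁♯ ⊂ V₁ × V₁`. -/
def InR {n : ℕ} (A : Matrix (Fin n) (Fin n) ℤ) (u : (Fin n → ℚ) × (Fin n → ℚ)) : Prop :=
  IsIntVec u.1 ∧ InDual A u.2

/-- The ambient space `W = (V₁ × V₁) × V₂`. -/
abbrev WSp (n m : ℕ) : Type := ((Fin n → ℚ) × (Fin n → ℚ)) × (Fin m → ℚ)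

/-- The orthogonal direct sum form `Ψ = ψ_R ⊕ ψ_B` on `W`. -/
def PsiW {n m : ℕ} (A : Matrix (Fin n) (Fin n) ℤ) (B : Matrix (Fin m) (Fin m) ℤ)
    (f : (Fin n → ℚ) →ₗ[ℚ] (Fin m → ℚ)) (w w' : WSp n m) : ℚ :=
  psiR A B f w.1 w'.1 + psi B w.2 w'.2

/-- The map `ι : V₁ → W`, `ι(y) = ((0, y), f(y))`. -/
def iota {n m : ℕ} (f : (Fin n → ℚ) →ₗ[ℚ] (Fin m → ℚ)) (y : Fin n → ℚ) : WSp n m :=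
  ((0, y), f y)

/-- Membership in `S = {z ∈ R × R₂♯ : Ψ(z, ι(r)) = 0 for all r ∈ R₁♯}`. -/
def InS {n m : ℕ} (A : Matrix (Fin n) (Fin n) ℤ) (B : Matrix (Fin m) (Fin m) ℤ)
    (f : (Fin n → ℚ) →ₗ[ℚ] (Fin m → ℚ)) (w : WSp n m) : Prop :=
  (InR A w.1 ∧ InDual B w.2) ∧ ∀ r, InDual A r → PsiW A B f w (iota f r) = 0


lemma psi_add_left {k : ℕ} (M : Matrix (Fin k) (Fin k) ℤ) (x y z : Fin k → ℚ) :
    psi M (x + y) z = psi M x z + psi M y z := by simp [psi, add_dotProduct]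

lemma psi_sub_left {k : ℕ} (M : Matrix (Fin k) (Fin k) ℤ) (x y z : Fin k → ℚ) :
    psi M (x - y) z = psi M x z - psi M y z := by simp [psi, sub_dotProduct]

lemma psi_add_right {k : ℕ} (M : Matrix (Fin k) (Fin k) ℤ) (x y z : Fin k → ℚ) :
    psi M x (y + z) = psi M x y + psi M x z := by simp [psi, mulVec_add]

lemma psi_smul_right {k : ℕ} (M : Matrix (Fin k) (Fin k) ℤ) (x y : Fin k → ℚ) (c : ℚ) :
    psi M x (c • y) = c * psi M x y := by simp [psi, mulVec_smul]

lemma psi_zero_left {k : ℕ} (M : Matrix (Fin k) (Fin k) ℤ) (x : Fin k → ℚ) :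
    psi M 0 x = 0 := by simp [psi]

lemma psi_symm {k : ℕ} {M : Matrix (Fin k) (Fin k) ℤ} (hM : M.IsSymm) (x y : Fin k → ℚ) :
    psi M x y = psi M y x := by
  have h : (M.map (fun a => (a : ℚ)))ᵀ = M.map (fun a => (a : ℚ)) := by
    rw [← transpose_map, hM.eq]
  unfold psi
  rw [dotProduct_mulVec, ← mulVec_transpose, h, dotProduct_comm]

lemma isIntQ_add {a b : ℚ} (ha : IsIntQ a) (hb : IsIntQ b) : IsIntQ (a + b) := by
  obtain ⟨a, rfl⟩ := ha
  obtain ⟨b, rfl⟩ := hb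
  exact ⟨a + b, by push_cast; rfl⟩

lemma isIntQ_sub {a b : ℚ} (ha : IsIntQ a) (hb : IsIntQ b) : IsIntQ (a - b) := by
  obtain ⟨a, rfl⟩ := ha
  obtain ⟨b, rfl⟩ := hb
  exact ⟨a - b, by push_cast; rfl⟩

lemma isIntQ_mul {a b : ℚ} (ha : IsIntQ a) (hb : IsIntQ b) : IsIntQ (a * b) := by
  obtain ⟨a, rfl⟩ := ha
  obtain ⟨b, rfl⟩ := hb
  exact ⟨a * b, by push_cast; rfl⟩

lemma isIntQ_sum {k : ℕ} {g : Fin k → ℚ} (h : ∀ i, IsIntQ (g i)) : IsIntQ (∑ i, g i) := by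
  choose a ha using h
  exact ⟨∑ i, a i, by push_cast; exact Finset.sum_congr rfl fun i _ => ha i⟩

lemma isIntVec_add {k : ℕ} {x y : Fin k → ℚ} (hx : IsIntVec x) (hy : IsIntVec y) :
    IsIntVec (x + y) := fun i => isIntQ_add (hx i) (hy i)

lemma isIntVec_sub {k : ℕ} {x y : Fin k → ℚ} (hx : IsIntVec x) (hy : IsIntVec y) :
    IsIntVec (x - y) := fun i => isIntQ_sub (hx i) (hy i)

lemma inDual_add {k : ℕ} {M : Matrix (Fin k) (Fin k) ℤ} {x y : Fin k → ℚ}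
    (hx : InDual M x) (hy : InDual M y) : InDual M (x + y) := fun z hz => by
  rw [psi_add_left]; exact isIntQ_add (hx z hz) (hy z hz)

lemma inDual_sub {k : ℕ} {M : Matrix (Fin k) (Fin k) ℤ} {x y : Fin k → ℚ}
    (hx : InDual M x) (hy : InDual M y) : InDual M (x - y) := fun z hz => by
  rw [psi_sub_left]; exact isIntQ_sub (hx z hz) (hy z hz)

lemma inDual_of_int {k : ℕ} (M : Matrix (Fin k) (Fin k) ℤ) {x : Fin k → ℚ}
    (hx : IsIntVec x) : InDual M x := fun y hy =>
  isIntQ_sum fun i => isIntQ_mul (hx i) (isIntQ_sum fun j => isIntQ_mul ⟨M i j, rfl⟩ (hy j))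

/-- Dual basis. -/
lemma exists_dual_basis {k : ℕ} {M : Matrix (Fin k) (Fin k) ℤ} (hM : M.IsSymm)
    (hd : M.det ≠ 0) : ∃ e : Fin k → (Fin k → ℚ), (∀ i, InDual M (e i)) ∧
      (∀ x i, psi M x (e i) = x i) ∧
      (∀ φ : (Fin k → ℚ) →ₗ[ℚ] ℚ, ∀ r, psi M (fun i => φ (e i)) r = φ r) := by
  set N : Matrix (Fin k) (Fin k) ℚ := M.map (fun a => (a : ℚ)) with hN
  have hdet : IsUnit N.det := by
    have : N.det = (M.det : ℚ) := (Int.cast_det M).symm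
    rw [this, isUnit_iff_ne_zero]
    exact_mod_cast hd
  have key : ∀ x i, psi M x (N⁻¹ *ᵥ Pi.single i 1) = x i := fun x i => by
    unfold psi
    rw [← hN, mulVec_mulVec, mul_nonsing_inv _ hdet, one_mulVec, dotProduct_single_one]
  refine ⟨fun i => N⁻¹ *ᵥ Pi.single i 1, fun i y hy => ?_, key, fun φ r => ?_⟩
  · rw [psi_symm hM, key]; exact hy i
  · have h : r = ∑ i, (N *ᵥ r) i • (N⁻¹ *ᵥ (Pi.single i 1 : Fin k → ℚ)) := by
      have h1 : N *ᵥ r = ∑ i, (N *ᵥ r) i • (Pi.single i 1 : Fin k → ℚ) :=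
        pi_eq_sum_univ' _
      have h2 : r = N⁻¹ *ᵥ (N *ᵥ r) := by
        rw [mulVec_mulVec, nonsing_inv_mul _ hdet, one_mulVec]
      conv_lhs => rw [h2, h1]
      rw [mulVec_sum]
      simp only [mulVec_smul]
    conv_rhs => rw [h]
    rw [map_sum]
    unfold psi
    simp only [dotProduct, map_smul, smul_eq_mul]
    exact Finset.sum_congr rfl fun i _ => mul_comm _ _

lemma PsiW_iota {n m : ℕ} (A : Matrix (Fin n) (Fin n) ℤ) (B : Matrix (Fin m) (Fin m) ℤ)
    (f : (Fin n → ℚ) →ₗ[ℚ] (Fin m → ℚ)) (w : WSp n m) (r : Fin n → ℚ) :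
    PsiW A B f w (iota f r) =
      psi A w.1.1 r + psi A w.1.2 r - psi B (f w.1.2) (f r) + psi B w.2 (f r) := by
  simp [PsiW, psiR, iota, psi_zero_left]

lemma PsiW_add_iota {n m : ℕ} (A : Matrix (Fin n) (Fin n) ℤ) (B : Matrix (Fin m) (Fin m) ℤ)
    (f : (Fin n → ℚ) →ₗ[ℚ] (Fin m → ℚ)) (w : WSp n m) (v r : Fin n → ℚ) :
    PsiW A B f (w + iota f v) (iota f r) = PsiW A B f w (iota f r) + psi A v r := by
  rw [PsiW_iota, PsiW_iota]
  simp only [iota, Prod.fst_add, Prod.snd_add, map_add, psi_add_left, psi_zero_left]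
  ring

/-- `R × R₂ = S ⊕ ι(R₁)`: every element of `R × R₂` decomposes
uniquely as `s + ι(w)` with `s ∈ S` and `w ∈ R₁`. -/
theorem R_R2_eq_S_oplus_iota_R1 {n m : ℕ}
    (A : Matrix (Fin n) (Fin n) ℤ) (hAsym : A.IsSymm) (hAdet : A.det ≠ 0)
    (B : Matrix (Fin m) (Fin m) ℤ) (hBsym : B.IsSymm) (hBdet : B.det ≠ 0)
    (f : (Fin n → ℚ) →ₗ[ℚ] (Fin m → ℚ))
    (hfdual : ∀ x, InDual A x → InDual B (f x))
    (hfint : ∀ x, IsIntVec x → IsIntVec (f x))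
    (hfinj : ∀ x, InDual A x → IsIntVec (f x) → IsIntVec x)
    (hfsurj : ∀ z, InDual B z → ∃ x, InDual A x ∧ IsIntVec (z - f x))
    (hfiso : ∀ x y, InDual A x → InDual A y → IsIntQ (psi B (f x) (f y) - psi A x y)) :
    (∀ w : WSp n m, IsIntVec w.1.1 ∧ InDual A w.1.2 ∧ IsIntVec w.2 →
      ∃! p : WSp n m × (Fin n → ℚ),
        InS A B f p.1 ∧ IsIntVec p.2 ∧ w = p.1 + iota f p.2) ∧
    (∀ (s : WSp n m) (r : Fin n → ℚ), InS A B f s → IsIntVec r →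
      IsIntVec (s + iota f r).1.1 ∧ InDual A (s + iota f r).1.2 ∧
        IsIntVec (s + iota f r).2) := by
  obtain ⟨e, heD, hee, heφ⟩ := exists_dual_basis hAsym hAdet
  obtain ⟨d, hdD, hde, -⟩ := exists_dual_basis hBsym hBdet
  refine ⟨?_, ?_⟩
  · rintro w ⟨hx, hy, hz⟩
    let φ : (Fin n → ℚ) →ₗ[ℚ] ℚ :=
      { toFun := fun r => PsiW A B f w (iota f r)
        map_add' := fun a b => by
          simp only [PsiW_iota, map_add, psi_add_right]; ring
        map_smul' := fun c a => by
          simp only [PsiW_iota, map_smul, psi_smul_right, RingHom.id_apply, smul_eq_mul]; ring }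
    have hφ : ∀ r, psi A (fun i => φ (e i)) r = PsiW A B f w (iota f r) := heφ φ
    generalize (fun i => φ (e i)) = v at hφ
    have hv : IsIntVec v := fun i => by
      rw [← hee v i, hφ, PsiW_iota]
      have h1 : IsIntQ (psi A w.1.1 (e i)) := by
        rw [psi_symm hAsym]; exact heD i _ hx
      have h2 := hfiso _ _ hy (heD i)
      have h3 : IsIntQ (psi B w.2 (f (e i))) := by
        rw [psi_symm hBsym]; exact hfdual _ (heD i) _ hz
      have h4 := isIntQ_add (isIntQ_sub h1 h2) h3
      convert h4 using 1
      ring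
    refine ⟨(w - iota f v, v), ⟨⟨⟨⟨?_, ?_⟩, ?_⟩, ?_⟩, hv, ?_⟩, ?_⟩
    · simpa [iota] using hx
    · exact inDual_sub hy (inDual_of_int A hv)
    · exact inDual_of_int B (isIntVec_sub hz (hfint v hv))
    · intro r _
      have h := PsiW_add_iota A B f (w - iota f v) v r
      rw [sub_add_cancel, ← hφ] at h
      linarith
    · simp
    · rintro ⟨s, u⟩ ⟨hs, hu, hw⟩
      simp only at hs hu hw
      have huv : u = v := by
        funext i
        rw [← hee u i, ← hee v i, hφ, hw, PsiW_add_iota, hs.2 _ (heD i), zero_add]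
      subst huv
      rw [hw, add_sub_cancel_right]
  · rintro s r ⟨⟨⟨hx, hy⟩, hz⟩, hs⟩ hr
    refine ⟨by simpa [iota] using hx, inDual_add hy (inDual_of_int A hr),
      isIntVec_add ?_ (hfint r hr)⟩
    intro i
    rw [← hde s.2 i]
    obtain ⟨t, ht, hti⟩ := hfsurj _ (hdD i)
    have h0 := hs t ht
    rw [PsiW_iota] at h0
    have h1 : IsIntQ (psi A s.1.1 t) := by
      rw [psi_symm hAsym]; exact ht _ hx
    have h4 := isIntQ_add (isIntQ_sub (hfiso _ _ hy ht) h1) (hz _ hti)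
    have h5 : psi B s.2 (d i) = psi B s.2 (d i - f t) + psi B s.2 (f t) := by
      rw [← psi_add_right, sub_add_cancel]
    rw [h5]
    convert h4 using 1
    linarith
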